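/- arXiv:2110.13649 — 2 statements merged into one kernel-verified Lean document; each statement's English description precedes it below -/
import Mathlib

section
/- If X has the Borel distribution with parameter μ ∈ (0,1), then its third cumulant equals μ(1+2μ)/(1-μ)^5. -/
open MeasureTheory

/-- The power series `∑ n ^ (n + k) / n! * x ^ n`. -/
noncomputable def abelSeries (k : ℕ) (x : ℝ) : ℝ :=
  ∑' n : ℕ, (n : ℝ) ^ (n + k) / n.factorial * x ^ n

lemma pow_self_div_factorial_le_exp_one_pow (n : ℕ) :
    (n : ℝ) ^ n / n.factorial ≤ Real.exp 1 ^ n := by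
  simpa [← Real.exp_nat_mul] using Real.pow_div_factorial_le_exp (n : ℝ) n.cast_nonneg n

lemma mul_exp_neg_lt_exp_neg_one {μ : ℝ} (hμ : μ ≠ 1) :
    μ * Real.exp (-μ) < Real.exp (-1) := by
  have h := Real.add_one_lt_exp (sub_ne_zero.2 hμ)
  rw [sub_add_cancel] at h
  calc μ * Real.exp (-μ) < Real.exp (μ - 1) * Real.exp (-μ) := by gcongr
    _ = Real.exp (-1) := by rw [← Real.exp_add]; ring_nf

lemma summable_abelSeries (k : ℕ) {x : ℝ} (hx : 0 ≤ x) (hx' : x < Real.exp (-1)) :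
    Summable fun n : ℕ ↦ (n : ℝ) ^ (n + k) / n.factorial * x ^ n := by
  have hr : ‖Real.exp 1 * x‖ < 1 := by
    rw [Real.norm_of_nonneg (by positivity)]
    calc Real.exp 1 * x < Real.exp 1 * Real.exp (-1) := by gcongr
      _ = 1 := by rw [← Real.exp_add]; simp
  refine .of_nonneg_of_le (fun n ↦ by positivity) (fun n ↦ ?_)
    (summable_pow_mul_geometric_of_norm_lt_one k hr)
  calc (n : ℝ) ^ (n + k) / n.factorial * x ^ n
      = (n : ℝ) ^ k * ((n : ℝ) ^ n / n.factorial * x ^ n) := by ring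
    _ ≤ (n : ℝ) ^ k * (Real.exp 1 ^ n * x ^ n) := by
      gcongr
      exact pow_self_div_factorial_le_exp_one_pow n
    _ = _ := by rw [mul_pow]

lemma hasDerivAt_abelSeries (k : ℕ) {x : ℝ} (hx : 0 < x) (hx' : x < Real.exp (-1)) :
    HasDerivAt (abelSeries k) (abelSeries (k + 1) x / x) x := by
  obtain ⟨r, hxr, hr⟩ := exists_between hx'
  have hr0 : 0 < r := hx.trans hxr
  have hshift (n : ℕ) {y : ℝ} (hy : 0 < y) :
      (n : ℝ) ^ (n + k) / n.factorial * (n * y ^ (n - 1)) =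
        (n : ℝ) ^ (n + (k + 1)) / n.factorial * y ^ n / y := by
    rcases n with _ | n
    · simp
    · rw [Nat.add_sub_cancel, pow_succ y]
      field_simp
      ring
  have h := hasDerivAt_tsum_of_isPreconnected (t := Set.Ioo 0 r) (y₀ := x) (y := x)
    (g := fun (n : ℕ) y ↦ (n : ℝ) ^ (n + k) / n.factorial * y ^ n)
    (g' := fun (n : ℕ) y ↦ (n : ℝ) ^ (n + k) / n.factorial * (n * y ^ (n - 1)))
    (u := fun n : ℕ ↦ (n : ℝ) ^ (n + k) / n.factorial * (n * r ^ (n - 1)))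
    ?_ isOpen_Ioo isPreconnected_Ioo (fun n y _ ↦ (hasDerivAt_pow n y).const_mul _)
    (fun n y hy ↦ ?_) ⟨hx, hxr⟩ (summable_abelSeries k hx.le hx') ⟨hx, hxr⟩
  · simp_rw [fun n ↦ hshift n hx, tsum_div_const] at h
    exact h
  · simp_rw [fun n ↦ hshift n hr0]
    exact (summable_abelSeries (k + 1) hr0.le hr).div_const r
  · have := hy.1
    rw [Real.norm_of_nonneg (by positivity)]
    gcongr
    exact hy.2.le

lemma analyticAt_abelSeries_zero {x : ℝ} (hx : 0 ≤ x) (hx' : x < Real.exp (-1)) :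
    AnalyticAt ℝ (abelSeries 0) x := by
  set p := FormalMultilinearSeries.ofScalars ℝ fun n : ℕ ↦ (n : ℝ) ^ n / n.factorial with hp
  have hsum : p.sum = abelSeries 0 := by
    ext y
    exact FormalMultilinearSeries.ofScalars_sum_eq _ y
  have hrad : ((Real.toNNReal (Real.exp (-1)) : NNReal) : ENNReal) ≤ p.radius := by
    refine p.le_radius_of_bound 1 fun n ↦ ?_
    rw [hp, FormalMultilinearSeries.ofScalars_norm, Real.norm_of_nonneg (by positivity),
      Real.coe_toNNReal _ (Real.exp_pos _).le]
    calc (n : ℝ) ^ n / n.factorial * Real.exp (-1) ^ n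
        ≤ Real.exp 1 ^ n * Real.exp (-1) ^ n := by
          gcongr
          exact pow_self_div_factorial_le_exp_one_pow n
      _ = 1 := by rw [← mul_pow, ← Real.exp_add]; simp
  have hpos : 0 < p.radius :=
    lt_of_lt_of_le (ENNReal.coe_pos.2 (Real.toNNReal_pos.2 (Real.exp_pos (-1)))) hrad
  rw [← hsum]
  refine (p.hasFPowerSeriesOnBall hpos).analyticAt_of_mem (Metric.mem_eball.2 ?_)
  refine lt_of_lt_of_le ?_ hrad
  rw [edist_dist, Real.dist_0_eq_abs, abs_of_nonneg hx, ← ENNReal.ofReal]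
  exact (ENNReal.ofReal_lt_ofReal_iff (Real.exp_pos _)).2 hx'

lemma sum_antidiagonal_neg_one_pow_mul_pow_div_factorial (m : ℕ) :
    ∑ p ∈ Finset.HasAntidiagonal.antidiagonal m,
      (-1 : ℝ) ^ p.2 * (p.1 : ℝ) ^ m / (p.1.factorial * p.2.factorial) = 1 := by
  have h := congrFun (fwdDiff_iter_eq_factorial (R := ℝ) (n := m)) 0
  rw [fwdDiff_iter_eq_sum_shift] at h
  rw [Finset.Nat.sum_antidiagonal_eq_sum_range_succ_mk]
  have hm : (m.factorial : ℝ) ≠ 0 := by positivity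
  rw [← mul_right_inj' hm, mul_one]
  refine Eq.trans ?_ h
  rw [Finset.mul_sum]
  refine Finset.sum_congr rfl fun k hk ↦ ?_
  have hk : k ≤ m := Nat.lt_succ_iff.1 (Finset.mem_range.1 hk)
  simp only [zsmul_eq_mul, Int.cast_mul, Int.cast_pow, Int.cast_neg, Int.cast_one,
    Int.cast_natCast, nsmul_eq_mul, mul_one, zero_add]
  rw [Nat.cast_choose ℝ hk]
  ring

lemma abelSeries_zero_mul_exp_neg_of_lt {μ : ℝ} (hμ : 0 < μ) (hμ' : μ < 1 / 8) :
    abelSeries 0 (μ * Real.exp (-μ)) = (1 - μ)⁻¹ := by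
  have hsmall : μ * Real.exp μ < Real.exp (-1) := by
    have h1 : μ * Real.exp μ ≤ 1 / 8 * Real.exp 1 := by
      gcongr
      linarith
    have h2 := Real.exp_one_lt_d9
    have h3 : Real.exp 1 * Real.exp (-1) = 1 := by rw [← Real.exp_add]; simp
    have h4 := Real.exp_pos (-1)
    nlinarith [Real.exp_pos 1]
  let f : ℕ × ℕ → ℝ := fun p ↦
    (p.1 : ℝ) ^ p.1 / p.1.factorial * μ ^ p.1 * ((-(p.1 * μ)) ^ p.2 / p.2.factorial)
  have hexp (y : ℝ) : HasSum (fun j : ℕ ↦ y ^ j / j.factorial) (Real.exp y) := by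
    rw [Real.exp_eq_exp_ℝ]
    exact NormedSpace.expSeries_div_hasSum_exp y
  have hnorm (p : ℕ × ℕ) : ‖f p‖ =
      (p.1 : ℝ) ^ p.1 / p.1.factorial * μ ^ p.1 * ((p.1 * μ) ^ p.2 / p.2.factorial) := by
    simp [f, abs_of_pos hμ]
  have hf : Summable f := by
    refine .of_norm ((summable_prod_of_nonneg fun _ ↦ norm_nonneg _).2 ⟨fun n ↦ ?_, ?_⟩)
    · simp_rw [hnorm]
      exact (hexp _).summable.mul_left _
    · simp_rw [hnorm, tsum_mul_left, (hexp _).tsum_eq]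
      refine (summable_abelSeries 0 (by positivity) hsmall).congr fun n ↦ ?_
      rw [mul_pow, ← Real.exp_nat_mul, add_zero, mul_assoc]
  have hrow : HasSum (fun n : ℕ ↦ (n : ℝ) ^ (n + 0) / n.factorial * (μ * Real.exp (-μ)) ^ n)
      (∑' p, f p) := by
    refine hf.hasSum.prod_fiberwise fun n ↦ ?_
    have h := (hexp (-(n * μ))).mul_left ((n : ℝ) ^ n / n.factorial * μ ^ n)
    rw [← mul_neg, Real.exp_nat_mul, mul_assoc, ← mul_pow] at h
    simpa only [f, add_zero, mul_neg] using h
  have hdiag : HasSum (fun m : ℕ ↦ μ ^ m) (∑' p, f p) := by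
    refine ((Finset.HasAntidiagonal.sigmaAntidiagonalEquivProd.hasSum_iff).2
      hf.hasSum).sigma fun m ↦ ?_
    convert hasSum_fintype _ using 1
    simp only [Function.comp_apply, Finset.HasAntidiagonal.sigmaAntidiagonalEquivProd_apply]
    rw [Finset.univ_eq_attach, Finset.sum_attach (Finset.HasAntidiagonal.antidiagonal m) f]
    calc μ ^ m = μ ^ m * ∑ p ∈ Finset.HasAntidiagonal.antidiagonal m,
          (-1 : ℝ) ^ p.2 * (p.1 : ℝ) ^ m / (p.1.factorial * p.2.factorial) := by
          rw [sum_antidiagonal_neg_one_pow_mul_pow_div_factorial, mul_one]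
      _ = _ := by
          rw [Finset.mul_sum]
          refine Finset.sum_congr rfl fun p hp ↦ ?_
          rw [← Finset.HasAntidiagonal.mem_antidiagonal.1 hp]
          simp only [f]
          rw [neg_pow (_ * μ), mul_pow _ μ, pow_add, pow_add]
          field_simp
  rw [abelSeries, hrow.tsum_eq, ← hdiag.tsum_eq, tsum_geometric_of_lt_one hμ.le (by linarith)]

lemma abelSeries_zero_mul_exp_neg {μ : ℝ} (hμ : μ ∈ Set.Ioo (0 : ℝ) 1) :
    abelSeries 0 (μ * Real.exp (-μ)) = (1 - μ)⁻¹ := by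
  refine AnalyticOnNhd.eqOn_of_preconnected_of_eventuallyEq (𝕜 := ℝ) (z₀ := 1 / 16)
    (f := fun ν ↦ abelSeries 0 (ν * Real.exp (-ν))) (g := fun ν ↦ (1 - ν)⁻¹)
    (fun ν hν ↦ ?_) (fun ν hν ↦ ?_) isPreconnected_Ioo (by norm_num) ?_ hμ
  · exact (analyticAt_abelSeries_zero (mul_nonneg hν.1.le (Real.exp_pos _).le)
      (mul_exp_neg_lt_exp_neg_one hν.2.ne)).fun_comp (f := fun ν : ℝ ↦ ν * Real.exp (-ν))
      (by fun_prop)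
  · exact (analyticAt_const.sub analyticAt_id).inv (sub_pos.2 hν.2).ne'
  · filter_upwards [Ioo_mem_nhds (show (0 : ℝ) < 1 / 16 by norm_num)
      (show (1 / 16 : ℝ) < 1 / 8 by norm_num)] with ν hν
    exact abelSeries_zero_mul_exp_neg_of_lt hν.1 hν.2

lemma abelSeries_succ_mul_exp_neg {k : ℕ} {g : ℝ → ℝ} {g' μ : ℝ} (hμ : μ ∈ Set.Ioo (0 : ℝ) 1)
    (h : ∀ ν ∈ Set.Ioo (0 : ℝ) 1, abelSeries k (ν * Real.exp (-ν)) = g ν)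
    (hg : HasDerivAt g g' μ) :
    abelSeries (k + 1) (μ * Real.exp (-μ)) = μ * g' / (1 - μ) := by
  have hμ0 := hμ.1
  have hμ1 := sub_pos.2 hμ.2
  have hin : HasDerivAt (fun ν : ℝ ↦ ν * Real.exp (-ν)) ((1 - μ) * Real.exp (-μ)) μ := by
    refine ((hasDerivAt_id' μ).mul (hasDerivAt_neg μ).exp).congr_deriv ?_
    ring
  have hcomp := (hasDerivAt_abelSeries k (mul_pos hμ0 (Real.exp_pos (-μ)))
    (mul_exp_neg_lt_exp_neg_one hμ.2.ne)).comp μ hin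
  have huniq := hcomp.unique (hg.congr_of_eventuallyEq
    (Filter.eventuallyEq_of_mem (Ioo_mem_nhds hμ.1 hμ.2) h))
  rw [← huniq]
  field_simp

lemma abelSeries_one_mul_exp_neg {μ : ℝ} (hμ : μ ∈ Set.Ioo (0 : ℝ) 1) :
    abelSeries 1 (μ * Real.exp (-μ)) = μ / (1 - μ) ^ 3 := by
  have hμ1 := (sub_pos.2 hμ.2).ne'
  rw [abelSeries_succ_mul_exp_neg hμ (fun ν hν ↦ abelSeries_zero_mul_exp_neg hν)
    (((hasDerivAt_id μ).const_sub 1).inv hμ1)]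
  simp only [id]
  field_simp

lemma abelSeries_two_mul_exp_neg {μ : ℝ} (hμ : μ ∈ Set.Ioo (0 : ℝ) 1) :
    abelSeries 2 (μ * Real.exp (-μ)) = μ * (1 + 2 * μ) / (1 - μ) ^ 5 := by
  have hμ1 := (sub_pos.2 hμ.2).ne'
  rw [abelSeries_succ_mul_exp_neg hμ (fun ν hν ↦ abelSeries_one_mul_exp_neg hν)
    ((hasDerivAt_id μ).div (((hasDerivAt_id μ).const_sub 1).pow 3) (pow_ne_zero 3 hμ1))]
  simp only [id]
  field_simp
  ring

lemma borel_integral_pow {Ω : Type*} [MeasurableSpace Ω]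
    (P : Measure Ω) {μ : ℝ} (hμ : μ ∈ Set.Ioo (0 : ℝ) 1)
    {X : Ω → ℕ} (hX : Measurable X)
    (hlaw : ∀ n : ℕ, 1 ≤ n → P {ω | X ω = n} =
      ENNReal.ofReal (Real.exp (-(μ * (n:ℝ))) * (μ * (n:ℝ)) ^ (n - 1) / (n.factorial : ℝ)))
    (k : ℕ) :
    ∫ ω, (X ω : ℝ) ^ (k + 1) ∂P =
      (abelSeries k (μ * Real.exp (-μ)) - if k = 0 then 1 else 0) / μ := by
  have hμ0 := hμ.1
  set x := μ * Real.exp (-μ) with hx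
  have hx0 : 0 < x := mul_pos hμ0 (Real.exp_pos _)
  have hsum := hasSum_ite_sub_hasSum ((summable_abelSeries k hx0.le
    (mul_exp_neg_lt_exp_neg_one hμ.2.ne)).hasSum.div_const μ) 0
  have hterm (n : ℕ) : ENNReal.ofReal ((n : ℝ) ^ (k + 1)) * P.map X {n} =
      ENNReal.ofReal (if n = 0 then 0 else (n : ℝ) ^ (n + k) / n.factorial * x ^ n / μ) := by
    rcases n with _ | n
    · simp
    · rw [Measure.map_apply hX (measurableSet_singleton _), if_neg n.succ_ne_zero]
      change _ * P {ω | X ω = n + 1} = _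
      rw [hlaw _ (by lia), ← ENNReal.ofReal_mul (by positivity), hx, mul_pow μ (Real.exp _),
        ← Real.exp_nat_mul, Nat.add_sub_cancel]
      congr 1
      rw [show -(μ * ((n + 1 : ℕ) : ℝ)) = ((n + 1 : ℕ) : ℝ) * -μ by ring]
      field_simp
      ring
  rw [integral_eq_lintegral_of_nonneg_ae (.of_forall fun ω ↦ by positivity)
    (by fun_prop), ← lintegral_map (f := fun n : ℕ ↦ ENNReal.ofReal ((n : ℝ) ^ (k + 1)))
    (by fun_prop) hX, lintegral_countable']
  simp_rw [hterm]
  rw [← ENNReal.ofReal_tsum_of_nonneg (fun n ↦ by split_ifs <;> positivity) hsum.summable,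
    hsum.tsum_eq, ENNReal.toReal_ofReal (hsum.nonneg fun n ↦ by split_ifs <;> positivity)]
  rcases eq_or_ne k 0 with rfl | hk
  · simp [abelSeries, sub_div]
  · simp [abelSeries, hk]

/-- If `X` has the Borel distribution with parameter `μ ∈ (0,1)`, i.e.
`P(X = n) = e^{-μn}(μn)^{n-1}/n!` for `n ≥ 1`, then its third cumulant
`E[X³] - 3E[X²]E[X] + 2(E[X])³` equals `μ(1+2μ)/(1-μ)⁵`. -/
theorem borel_third_cumulant {Ω : Type*} [MeasurableSpace Ω]
    (P : Measure Ω) [IsProbabilityMeasure P] (μ : ℝ) (hμ : μ ∈ Set.Ioo (0:ℝ) 1)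
    (X : Ω → ℕ) (hX : Measurable X)
    (hlaw : ∀ n : ℕ, 1 ≤ n → P {ω | X ω = n} =
      ENNReal.ofReal (Real.exp (-(μ * (n:ℝ))) * (μ * (n:ℝ)) ^ (n - 1) / (n.factorial : ℝ))) :
    (∫ ω, ((X ω : ℝ)) ^ 3 ∂P) - 3 * (∫ ω, ((X ω : ℝ)) ^ 2 ∂P) * (∫ ω, (X ω : ℝ) ∂P)
      + 2 * (∫ ω, (X ω : ℝ) ∂P) ^ 3 = μ * (1 + 2 * μ) / (1 - μ) ^ 5 := by
  have hμ0 := hμ.1.ne'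
  have hμ1 := (sub_pos.2 hμ.2).ne'
  have h1 := borel_integral_pow P hμ hX hlaw 0
  have h2 := borel_integral_pow P hμ hX hlaw 1
  have h3 := borel_integral_pow P hμ hX hlaw 2
  simp only [zero_add, pow_one, Nat.reduceAdd, if_true, one_ne_zero, two_ne_zero, if_false,
    sub_zero, abelSeries_zero_mul_exp_neg hμ, abelSeries_one_mul_exp_neg hμ,
    abelSeries_two_mul_exp_neg hμ] at h1 h2 h3
  rw [h1, h2, h3]
  field_simp
  ring
end

section
/- If X has the Borel distribution with parameter μ ∈ (0,1), then its fourth cumulant equals μ(1 + 8μ + 6μ^2)/(1-μ)^7. -/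
open MeasureTheory

open Filter Topology

/-- The coefficients of the power series obtained from the tree function
`∑ n ^ (n - 1) / n! * x ^ n` by applying `x * d/dx` repeatedly `k` times. -/
noncomputable def treeCoeff (k n : ℕ) : ℝ := (n : ℝ) ^ k * ((n : ℝ) ^ n / (n.factorial : ℝ) / n)

/-- The `k`-fold image of the tree function under `x * d/dx`. -/
noncomputable def treeSeries (k : ℕ) (x : ℝ) : ℝ := ∑' n, treeCoeff k n * x ^ n

lemma treeCoeff_nonneg (k n : ℕ) : 0 ≤ treeCoeff k n := by
  unfold treeCoeff; positivity

lemma treeCoeff_zero_right (k : ℕ) : treeCoeff k 0 = 0 := by simp [treeCoeff]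

lemma treeCoeff_succ (k n : ℕ) : treeCoeff (k + 1) n = n * treeCoeff k n := by
  unfold treeCoeff; ring

lemma treeCoeff_le (k n : ℕ) : treeCoeff k n ≤ (n : ℝ) ^ k * Real.exp 1 ^ n := by
  unfold treeCoeff
  gcongr
  rcases Nat.eq_zero_or_pos n with rfl | hn
  · simp
  · have h1 : (1 : ℝ) ≤ n := by exact_mod_cast hn
    calc (n : ℝ) ^ n / (n.factorial : ℝ) / n ≤ (n : ℝ) ^ n / (n.factorial : ℝ) :=
          div_le_self (by positivity) h1
      _ ≤ Real.exp n := Real.pow_div_factorial_le_exp n (by positivity) n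
      _ = Real.exp 1 ^ n := by rw [← Real.exp_nat_mul, mul_one]

lemma summable_treeCoeff (k : ℕ) {r : ℝ} (hr0 : 0 ≤ r) (hr : Real.exp 1 * r < 1) :
    Summable fun n ↦ treeCoeff k n * r ^ n := by
  refine Summable.of_nonneg_of_le (fun n ↦ mul_nonneg (treeCoeff_nonneg k n) (by positivity))
    (fun n ↦ ?_) (summable_pow_mul_geometric_of_norm_lt_one (r := Real.exp 1 * r) k ?_)
  · rw [mul_pow, ← mul_assoc]
    gcongr
    exact treeCoeff_le k n
  · rwa [Real.norm_of_nonneg (by positivity)]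

lemma hasDerivAt_treeSeries (k : ℕ) {x : ℝ} (hx0 : 0 < x) (hx : Real.exp 1 * x < 1) :
    HasDerivAt (treeSeries k) (treeSeries (k + 1) x / x) x := by
  have hx' : x < (Real.exp 1)⁻¹ := by
    rw [lt_inv_comm₀ hx0 (Real.exp_pos 1), ← one_div, lt_div_iff₀ hx0]; exact hx
  obtain ⟨r, hxr, hr⟩ := exists_between hx'
  have hr0 : 0 < r := hx0.trans hxr
  have hr1 : Real.exp 1 * r < 1 := by
    calc Real.exp 1 * r < Real.exp 1 * (Real.exp 1)⁻¹ := by gcongr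
      _ = 1 := mul_inv_cancel₀ (Real.exp_pos 1).ne'
  have hterm : ∀ n : ℕ, ∀ y : ℝ, y ≠ 0 →
      treeCoeff k n * (n * y ^ (n - 1)) = treeCoeff (k + 1) n * y ^ n / y := by
    intro n y hy
    rcases n with _ | n
    · simp [treeCoeff_zero_right]
    · rw [treeCoeff_succ, Nat.add_sub_cancel, pow_succ]
      field_simp
  have key := hasDerivAt_tsum_of_isPreconnected
    (g := fun n y ↦ treeCoeff k n * y ^ n) (g' := fun n y ↦ treeCoeff k n * (n * y ^ (n - 1)))
    (u := fun n ↦ treeCoeff k n * (n * r ^ (n - 1))) (t := Set.Ioo 0 r) (y₀ := x) (y := x)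
    ?_ isOpen_Ioo isPreconnected_Ioo (fun n y _ ↦ (hasDerivAt_pow n y).const_mul _) ?_ ⟨hx0, hxr⟩
    (summable_treeCoeff k hx0.le hx) ⟨hx0, hxr⟩
  · convert! key using 1
    simp_rw [hterm _ x hx0.ne', tsum_div_const]
    rfl
  · simp_rw [hterm _ r hr0.ne']
    exact (summable_treeCoeff (k + 1) hr0.le hr1).div_const r
  · rintro n y ⟨hy0, hyr⟩
    have := treeCoeff_nonneg k n
    rw [Real.norm_of_nonneg (by positivity)]
    gcongr

lemma analyticAt_treeSeries (k : ℕ) {x : ℝ} (hx0 : 0 ≤ x) (hx : Real.exp 1 * x < 1) :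
    AnalyticAt ℝ (treeSeries k) x := by
  have hx' : x < (Real.exp 1)⁻¹ := by
    rwa [← one_div, lt_div_iff₀' (Real.exp_pos 1)]
  obtain ⟨r, hxr, hr⟩ := exists_between hx'
  have hr0 : 0 < r := hx0.trans_lt hxr
  have hr1 : Real.exp 1 * r < 1 := by
    rwa [← one_div, lt_div_iff₀' (Real.exp_pos 1)] at hr
  lift r to NNReal using hr0.le
  have hrad : (r : ENNReal) ≤ (FormalMultilinearSeries.ofScalars ℝ (treeCoeff k)).radius := by
    apply FormalMultilinearSeries.le_radius_of_summable
    simp_rw [FormalMultilinearSeries.ofScalars_norm, Real.norm_of_nonneg (treeCoeff_nonneg k _)]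
    exact summable_treeCoeff k hr0.le hr1
  have hpos : 0 < (FormalMultilinearSeries.ofScalars ℝ (treeCoeff k)).radius :=
    lt_of_lt_of_le (by exact_mod_cast hr0) hrad
  have heq : treeSeries k = (FormalMultilinearSeries.ofScalars ℝ (treeCoeff k)).sum := by
    have := FormalMultilinearSeries.ofScalarsSum_eq_tsum (E := ℝ) (treeCoeff k)
    simp only [smul_eq_mul] at this
    exact this.symm
  rw [heq]
  refine (FormalMultilinearSeries.hasFPowerSeriesOnBall _ hpos).analyticAt_of_mem ?_
  refine Metric.eball_subset_eball hrad ?_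
  rw [Metric.mem_eball, edist_eq_enorm_sub, sub_zero, Real.enorm_of_nonneg hx0,
    ← ENNReal.ofReal_coe_nnreal]
  exact (ENNReal.ofReal_lt_ofReal_iff hr0).2 hxr

/-- Vanishing of the alternating binomial sums of low-degree powers. -/
lemma sum_antidiagonal_treeCoeff (m : ℕ) :
    ∑ p ∈ Finset.HasAntidiagonal.antidiagonal m, treeCoeff 0 p.1 * ((-(p.1 : ℝ)) ^ p.2 / p.2.factorial)
      = if m = 1 then 1 else 0 := by
  rcases m with _ | _ | m
  · simp [treeCoeff]
  · simp [Finset.Nat.antidiagonal_succ, treeCoeff]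
  have h := congrFun (fwdDiff_iter_pow_eq_zero_of_lt (R := ℝ) (Nat.lt_succ_self (m + 1))) 0
  rw [fwdDiff_iter_eq_sum_shift, ← Finset.Nat.sum_antidiagonal_eq_sum_range_succ
    (fun i j ↦ ((-1 : ℤ) ^ j * ((m + 1).succ.choose i : ℕ)) • ((0 + i • (1 : ℝ)) ^ (m + 1)))] at h
  have hm : m + 1 + 1 ≠ 1 := by omega
  rw [if_neg hm]
  have hf : ((m + 1 + 1).factorial : ℝ) ≠ 0 := by positivity
  rw [← mul_right_inj' hf, mul_zero, Finset.mul_sum]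
  refine Eq.trans (Finset.sum_congr rfl ?_) h
  rintro ⟨i, j⟩ hij
  rw [Finset.HasAntidiagonal.mem_antidiagonal] at hij
  dsimp only at hij ⊢
  rcases i with _ | i
  · simp [treeCoeff_zero_right]
  have hch : (((m + 1).succ.choose (i + 1) : ℕ) : ℝ)
      = (m + 1 + 1).factorial / ((i + 1).factorial * j.factorial) := by
    rw [eq_div_iff (by positivity), Nat.succ_eq_add_one, ← hij,
      Nat.choose_symm_add, ← Nat.add_choose_mul_factorial_mul_factorial (i + 1) j]
    push_cast
    ring
  have hpow : m + 1 = i + j := by omega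
  rw [zsmul_eq_mul]
  push_cast [hch, treeCoeff]
  rw [neg_pow, hpow]
  have : ((i : ℝ) + 1) ≠ 0 := by positivity
  simp only [nsmul_eq_mul]
  push_cast
  field_simp
  ring

lemma treeSeries_mul_exp_neg_of_small {x : ℝ} (hx : Real.exp 1 * (|x| * Real.exp |x|) < 1) :
    treeSeries 0 (x * Real.exp (-x)) = x := by
  let f : ℕ × ℕ → ℝ := fun p ↦ treeCoeff 0 p.1 * x ^ p.1 * ((-(p.1 * x)) ^ p.2 / p.2.factorial)
  have hexp : ∀ y : ℝ, HasSum (fun j : ℕ ↦ y ^ j / (j.factorial : ℝ)) (Real.exp y) := fun y ↦ by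
    rw [Real.exp_eq_exp_ℝ]; exact NormedSpace.expSeries_div_hasSum_exp y
  have hnorm : ∀ p, ‖f p‖ = treeCoeff 0 p.1 * |x| ^ p.1 * ((p.1 * |x|) ^ p.2 / p.2.factorial) := by
    intro p
    simp [f, abs_of_nonneg (treeCoeff_nonneg 0 p.1)]
  have hf : Summable f := by
    refine Summable.of_norm ?_
    rw [summable_prod_of_nonneg (fun _ ↦ norm_nonneg _)]
    simp_rw [hnorm]
    refine ⟨fun n ↦ (hexp _).summable.mul_left _, ?_⟩
    simp_rw [tsum_mul_left, (hexp _).tsum_eq]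
    refine (summable_treeCoeff 0 (by positivity) hx).congr fun n ↦ ?_
    rw [mul_pow, ← Real.exp_nat_mul, mul_assoc]
  have hrow : treeSeries 0 (x * Real.exp (-x)) = ∑' p, f p := by
    rw [hf.tsum_prod]
    refine tsum_congr fun n ↦ ?_
    simp only [f]
    rw [tsum_mul_left, (hexp _).tsum_eq, mul_pow, ← Real.exp_nat_mul, mul_assoc]
    congr 3
    ring
  have hdiag : ∑' p, f p = ∑' m, if m = 1 then x else 0 := by
    have hs := Finset.HasAntidiagonal.sigmaAntidiagonalEquivProd.summable_iff.mpr hf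
    rw [← Finset.HasAntidiagonal.sigmaAntidiagonalEquivProd.tsum_eq f]
    refine (hs.tsum_sigma' fun n ↦ (hasSum_fintype _).summable).trans (tsum_congr fun m ↦ ?_)
    have hm := congrArg (x ^ m * ·) (sum_antidiagonal_treeCoeff m)
    simp only [Finset.mul_sum] at hm
    rw [tsum_fintype]
    refine (Finset.sum_finset_coe f (Finset.HasAntidiagonal.antidiagonal m)).trans
      ((Finset.sum_congr rfl ?_).trans (hm.trans ?_))
    · rintro ⟨i, j⟩ hij
      rw [Finset.HasAntidiagonal.mem_antidiagonal] at hij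
      subst hij
      simp only [f]
      rw [← neg_mul, mul_pow, pow_add]
      ring
    · split_ifs with h <;> simp [h]
  rw [hrow, hdiag, tsum_ite_eq]

lemma exp_one_mul_mul_exp_neg_lt_one {x : ℝ} (hx : x < 1) :
    Real.exp 1 * (x * Real.exp (-x)) < 1 := by
  have h := Real.add_one_lt_exp (sub_ne_zero.mpr hx.ne)
  calc Real.exp 1 * (x * Real.exp (-x)) < Real.exp 1 * (Real.exp (x - 1) * Real.exp (-x)) := by
        gcongr; linarith
    _ = 1 := by rw [← Real.exp_add, ← Real.exp_add, Real.exp_eq_one_iff]; ring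

lemma treeSeries_mul_exp_neg {x : ℝ} (hx : x ∈ Set.Ico (0 : ℝ) 1) :
    treeSeries 0 (x * Real.exp (-x)) = x := by
  have hcont : ContinuousAt (fun x : ℝ ↦ Real.exp 1 * (|x| * Real.exp |x|)) 0 := by fun_prop
  have hev : ∀ᶠ x in 𝓝 (0 : ℝ), Real.exp 1 * (|x| * Real.exp |x|) < 1 :=
    hcont.eventually (gt_mem_nhds (by simp))
  refine AnalyticOnNhd.eqOn_of_preconnected_of_eventuallyEq (𝕜 := ℝ)
    (f := fun x ↦ treeSeries 0 (x * Real.exp (-x))) (g := fun x ↦ x) (z₀ := 0) ?_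
    (fun _ _ ↦ analyticAt_id) isPreconnected_Ico (by simp)
    (hev.mono fun x hx ↦ treeSeries_mul_exp_neg_of_small hx) hx
  rintro y ⟨hy0, hy1⟩
  exact (analyticAt_treeSeries 0 (by positivity) (exp_one_mul_mul_exp_neg_lt_one hy1)).fun_comp
    (f := fun x : ℝ ↦ x * Real.exp (-x)) (by fun_prop)

lemma treeSeries_succ_of_hasDerivAt {k : ℕ} {F : ℝ → ℝ} {F' x : ℝ}
    (hF : ∀ y ∈ Set.Ioo (0 : ℝ) 1, treeSeries k (y * Real.exp (-y)) = F y)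
    (hx : x ∈ Set.Ioo (0 : ℝ) 1) (hd : HasDerivAt F F' x) :
    treeSeries (k + 1) (x * Real.exp (-x)) = x * F' / (1 - x) := by
  obtain ⟨hx0, hx1⟩ := hx
  have hin : HasDerivAt (fun y : ℝ ↦ y * Real.exp (-y)) (Real.exp (-x) * (1 - x)) x := by
    convert! (hasDerivAt_id x).mul (hasDerivAt_neg x).exp using 1
    simp; ring
  have hcomp := (hasDerivAt_treeSeries k (by positivity)
    (exp_one_mul_mul_exp_neg_lt_one hx1)).comp x hin
  have hev : F =ᶠ[𝓝 x] treeSeries k ∘ fun y ↦ y * Real.exp (-y) :=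
    Filter.mem_of_superset (Ioo_mem_nhds hx0 hx1) fun y hy ↦ (hF y hy).symm
  have h := hd.unique (hcomp.congr_of_eventuallyEq hev)
  have h1 : 1 - x ≠ 0 := by linarith
  have := (Real.exp_pos (-x)).ne'
  rw [h]
  field_simp

lemma treeSeries_one {x : ℝ} (hx : x ∈ Set.Ioo (0 : ℝ) 1) :
    treeSeries 1 (x * Real.exp (-x)) = x / (1 - x) := by
  rw [treeSeries_succ_of_hasDerivAt (fun y hy ↦ treeSeries_mul_exp_neg ⟨hy.1.le, hy.2⟩) hx
    (hasDerivAt_id' x), mul_one]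

/-- One step of the recursion for quotients with denominator a power of `1 - x`. -/
lemma treeSeries_succ_of_div_pow {k n : ℕ} {p : ℝ → ℝ} {p' x : ℝ}
    (hF : ∀ y ∈ Set.Ioo (0 : ℝ) 1, treeSeries k (y * Real.exp (-y)) = p y / (1 - y) ^ n)
    (hx : x ∈ Set.Ioo (0 : ℝ) 1) (hp : HasDerivAt p p' x) :
    treeSeries (k + 1) (x * Real.exp (-x)) = x * (p' * (1 - x) + n * p x) / (1 - x) ^ (n + 2) := by
  have h1 : 1 - x ≠ 0 := by linarith [hx.2]
  have hq : HasDerivAt (fun y : ℝ ↦ (1 - y) ^ n) (n * (1 - x) ^ (n - 1) * (-1)) x :=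
    ((hasDerivAt_id' x).const_sub 1).pow n
  rw [treeSeries_succ_of_hasDerivAt hF hx (hp.div hq (pow_ne_zero n h1))]
  rcases n with _ | n
  · simp; field_simp
  · rw [Nat.add_sub_cancel]
    field_simp
    ring

lemma treeSeries_two {x : ℝ} (hx : x ∈ Set.Ioo (0 : ℝ) 1) :
    treeSeries 2 (x * Real.exp (-x)) = x / (1 - x) ^ 3 := by
  rw [treeSeries_succ_of_div_pow (n := 1) (p := fun y ↦ y)
    (fun y hy ↦ by rw [treeSeries_one hy, pow_one]) hx (hasDerivAt_id' x)]
  congr 1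
  push_cast
  ring

lemma treeSeries_three {x : ℝ} (hx : x ∈ Set.Ioo (0 : ℝ) 1) :
    treeSeries 3 (x * Real.exp (-x)) = x * (1 + 2 * x) / (1 - x) ^ 5 := by
  rw [treeSeries_succ_of_div_pow (fun y hy ↦ treeSeries_two hy) hx (hasDerivAt_id' x)]
  congr 1
  push_cast
  ring

lemma treeSeries_four {x : ℝ} (hx : x ∈ Set.Ioo (0 : ℝ) 1) :
    treeSeries 4 (x * Real.exp (-x)) = x * (1 + 8 * x + 6 * x ^ 2) / (1 - x) ^ 7 := by
  have hp : HasDerivAt (fun y : ℝ ↦ y * (1 + 2 * y)) (1 + 4 * x) x := by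
    convert! (hasDerivAt_id' x).mul (((hasDerivAt_id' x).const_mul 2).const_add 1) using 1
    ring
  rw [treeSeries_succ_of_div_pow (fun y hy ↦ treeSeries_three hy) hx hp]
  congr 1
  push_cast
  ring

/-- The moments of the Borel distribution in terms of the tree function. -/
lemma integral_pow_of_borel {Ω : Type*} [MeasurableSpace Ω]
    (P : Measure Ω) [IsProbabilityMeasure P] {μ : ℝ} (hμ : 0 < μ)
    {X : Ω → ℕ} (hX : Measurable X)
    (hlaw : ∀ n : ℕ, 1 ≤ n → P {ω | X ω = n} =
      ENNReal.ofReal (Real.exp (-(μ * (n:ℝ))) * (μ * (n:ℝ)) ^ (n - 1) / (n.factorial : ℝ)))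
    {k : ℕ} (hk : k ≠ 0) :
    ∫ ω, (X ω : ℝ) ^ k ∂P = treeSeries k (μ * Real.exp (-μ)) / μ := by
  have hmap : ∫ ω, (X ω : ℝ) ^ k ∂P = ∫ n, (n : ℝ) ^ k ∂(P.map X) :=
    (integral_map hX.aemeasurable
      (measurable_of_countable fun n : ℕ ↦ (n : ℝ) ^ k).aestronglyMeasurable).symm
  have : IsProbabilityMeasure (P.map X) := Measure.isProbabilityMeasure_map hX.aemeasurable
  rw [hmap, ← Measure.sum_smul_dirac (P.map X),
    integral_sum_dirac fun n ↦ measure_ne_top _ _, treeSeries, ← tsum_div_const]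
  refine tsum_congr fun n ↦ ?_
  rcases n with _ | n
  · simp [hk, treeCoeff_zero_right]
  rw [Measure.map_apply hX (measurableSet_singleton _)]
  change (P {ω | X ω = n + 1}).toReal • _ = _
  rw [hlaw (n + 1) (by omega), ENNReal.toReal_ofReal (by positivity), smul_eq_mul, treeCoeff,
    mul_pow, mul_pow, ← Real.exp_nat_mul, Nat.add_sub_cancel, mul_comm μ, mul_neg]
  have : ((n : ℝ) + 1) ≠ 0 := by positivity
  push_cast
  field_simp
  ring

/-- If `X` has the Borel distribution with parameter `μ ∈ (0,1)`, i.e.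
`P(X = n) = e^{-μn}(μn)^{n-1}/n!` for `n ≥ 1`, then its fourth cumulant
`E[X⁴] - 4E[X³]E[X] - 3(E[X²])² + 12E[X²](E[X])² - 6(E[X])⁴`
equals `μ(1 + 8μ + 6μ²)/(1-μ)⁷`. -/
theorem borel_fourth_cumulant {Ω : Type*} [MeasurableSpace Ω]
    (P : Measure Ω) [IsProbabilityMeasure P] (μ : ℝ) (hμ : μ ∈ Set.Ioo (0:ℝ) 1)
    (X : Ω → ℕ) (hX : Measurable X)
    (hlaw : ∀ n : ℕ, 1 ≤ n → P {ω | X ω = n} =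
      ENNReal.ofReal (Real.exp (-(μ * (n:ℝ))) * (μ * (n:ℝ)) ^ (n - 1) / (n.factorial : ℝ))) :
    (∫ ω, ((X ω : ℝ)) ^ 4 ∂P) - 4 * (∫ ω, ((X ω : ℝ)) ^ 3 ∂P) * (∫ ω, (X ω : ℝ) ∂P)
      - 3 * (∫ ω, ((X ω : ℝ)) ^ 2 ∂P) ^ 2
      + 12 * (∫ ω, ((X ω : ℝ)) ^ 2 ∂P) * (∫ ω, (X ω : ℝ) ∂P) ^ 2
      - 6 * (∫ ω, (X ω : ℝ) ∂P) ^ 4 = μ * (1 + 8 * μ + 6 * μ ^ 2) / (1 - μ) ^ 7 := by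
  have hμ1 : 1 - μ ≠ 0 := by linarith [hμ.2]
  have hμ0 : μ ≠ 0 := hμ.1.ne'
  have hone : ∫ ω, (X ω : ℝ) ∂P = treeSeries 1 (μ * Real.exp (-μ)) / μ := by
    simpa using integral_pow_of_borel P hμ.1 hX hlaw one_ne_zero
  rw [hone, integral_pow_of_borel P hμ.1 hX hlaw two_ne_zero,
    integral_pow_of_borel P hμ.1 hX hlaw three_ne_zero,
    integral_pow_of_borel P hμ.1 hX hlaw four_ne_zero,
    treeSeries_one hμ, treeSeries_two hμ, treeSeries_three hμ, treeSeries_four hμ]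
  field_simp
  ring
end
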